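/- Let B = conv{(1,0,0), (−1,0,0), (0,2,0)} ⊆ ℝ³, let u ∈ ℤ³ with u₃ ≠ 0, and suppose the prism P = conv(B ∪ (B + u)) belongs to 𝓜³, i.e., P is a maximal lattice-free integral polytope. Then there exist a matrix U ∈ ℤ^{3×3} with |det U| = 1 and a vector v ∈ ℤ³ such that P = U·M₁₁ + v, where M₁₁ = conv(B ∪ (B + (1,0,2))). -/

import Mathlib

open Set

/-- The set of integer points `ℤ^d` inside `ℝ^d`. -/
def intPts (d : ℕ) : Set (Fin d → ℝ) := {x | ∀ i, ∃ z : ℤ, x i = (z : ℝ)}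

/-- The lattice `Λ = s·ℤ^d` inside `ℝ^d`. -/
def sLat (d s : ℕ) : Set (Fin d → ℝ) := {x | ∀ i, ∃ z : ℤ, x i = (s : ℝ) * (z : ℝ)}

/-- A polyhedron: a finite intersection of closed halfspaces. -/
def IsPolyhedron {d : ℕ} (P : Set (Fin d → ℝ)) : Prop :=
  ∃ (n : ℕ) (A : Fin n → Fin d → ℝ) (b : Fin n → ℝ),
    P = {x | ∀ i, (∑ j, A i j * x j) ≤ b i}

/-- An integral set: it equals the convex hull of its integer points. -/
def IsIntegralPoly {d : ℕ} (P : Set (Fin d → ℝ)) : Prop :=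
  P = convexHull ℝ (P ∩ intPts d)

/-- The affine map `x ↦ U·x + t` with integer matrix `U` and translation `t : ℝ^d`. -/
noncomputable def affMap {d : ℕ} (U : Matrix (Fin d) (Fin d) ℤ) (t : Fin d → ℝ)
    (x : Fin d → ℝ) : Fin d → ℝ := fun i => (∑ j, (U i j : ℝ) * x j) + t i

/-- Membership in `𝓜³`: a maximal lattice-free integral polytope in `ℝ³`, i.e. a bounded
integral polyhedron with nonempty interior, whose interior contains no integer point, and
which is not properly contained in any convex set whose interior contains no integer point. -/
def MemM3 (P : Set (Fin 3 → ℝ)) : Prop :=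
  IsPolyhedron P ∧ Bornology.IsBounded P ∧ IsIntegralPoly P ∧ (interior P).Nonempty ∧
    interior P ∩ intPts 3 = ∅ ∧
    ∀ K : Set (Fin 3 → ℝ), Convex ℝ K → interior K ∩ intPts 3 = ∅ → P ⊆ K → P = K

def B11 : Set (Fin 3 → ℝ) :=
  convexHull ℝ ({![1,0,0], ![-1,0,0], ![0,2,0]} : Set (Fin 3 → ℝ))

def M11 : Set (Fin 3 → ℝ) :=
  convexHull ℝ (B11 ∪ (fun x => x + ![1,0,2]) '' B11)

/-- Integer points of the open prism over the triangle are unavoidable unless it has height two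
and a half-integral horizontal shift. -/
lemma height_eq_two_of_forall_not_mem (n p q : ℤ) (hn : 2 ≤ n)
    (h : ∀ a b k : ℤ, 0 < k → k < n → 0 < n * b - k * q →
      2 * (n * a - k * p) + (n * b - k * q) < 2 * n →
      -2 * (n * a - k * p) + (n * b - k * q) < 2 * n → False) :
    n = 2 ∧ (∃ c, p = 1 + 2 * c) ∧ ∃ m, q = 2 * m := by
  have hn0 : 0 < n := by lia
  obtain ⟨a, ha₁, ha₂⟩ : ∃ a, -n ≤ 2 * (n * a - p) ∧ 2 * (n * a - p) ≤ n := by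
    have h₁ := Int.emod_add_mul_ediv p n
    have h₂ := Int.emod_nonneg p hn0.ne'
    have h₃ := Int.emod_lt_of_pos p hn0
    by_cases hr : 2 * (p % n) ≤ n
    · exact ⟨p / n, by lia, by lia⟩
    · exact ⟨p / n + 1, by rw [mul_add]; lia, by rw [mul_add]; lia⟩
  have h₁ := Int.emod_add_mul_ediv q n
  have h₂ := Int.emod_nonneg q hn0.ne'
  have h₃ := Int.emod_lt_of_pos q hn0
  have key := h a (q / n + 1) 1 one_pos (by lia)
  rw [mul_add] at key
  have hq0 : q % n = 0 := by
    by_contra hne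
    exact key (by lia) (by lia) (by lia)
  have hpn : 2 * (n * a - p) = n ∨ 2 * (n * a - p) = -n := by
    by_contra hne
    exact key (by lia) (by lia) (by lia)
  obtain ⟨c, hc⟩ : ∃ c, 2 * p = n * (2 * c + 1) := by
    rcases hpn with hpn | hpn
    · exact ⟨a - 1, by linear_combination -hpn⟩
    · exact ⟨a, by linear_combination -hpn⟩
  have hq : q = n * (q / n) := by lia
  obtain rfl : n = 2 := by
    by_contra hne
    have e₁ : n * (2 * c + 1) - 2 * p = 0 := by lia
    have e₂ : n * (2 * (q / n) + 1) - 2 * q = n := by linear_combination -2 * hq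
    refine h (2 * c + 1) (2 * (q / n) + 1) 2 two_pos (by lia) ?_ ?_ ?_ <;> rw [e₂]
    · lia
    all_goals rw [e₁]; lia
  exact ⟨rfl, ⟨c, by lia⟩, ⟨q / 2, hq⟩⟩

lemma mem_B11 {x : Fin 3 → ℝ} (h₀ : 0 ≤ x 1) (h₁ : 2 * x 0 + x 1 ≤ 2)
    (h₂ : -2 * x 0 + x 1 ≤ 2) (h₃ : x 2 = 0) : x ∈ B11 := by
  have hc : Convex ℝ B11 := convex_convexHull ℝ _
  have hmem : ∀ y ∈ ({![1,0,0], ![-1,0,0], ![0,2,0]} : Set (Fin 3 → ℝ)), y ∈ B11 :=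
    fun y hy => subset_convexHull ℝ _ hy
  have hsum := hc.sum_mem (t := Finset.univ)
    (w := ![(2 + 2 * x 0 - x 1) / 4, (2 - 2 * x 0 - x 1) / 4, x 1 / 2])
    (z := ![![1,0,0], ![-1,0,0], ![0,2,0]])
    (by intro i _; fin_cases i <;> simp <;> linarith)
    (by simp [Fin.sum_univ_three]; ring)
    (by intro i _; apply hmem; fin_cases i <;> simp)
  convert hsum using 1
  ext i
  fin_cases i <;> simp [Fin.sum_univ_three, h₃]
  ring

lemma affMap_zero_eq_toLin' {d : ℕ} (U : Matrix (Fin d) (Fin d) ℤ) :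
    affMap U 0 = Matrix.toLin' (U.map (Int.cast : ℤ → ℝ)) := by
  ext x i
  simp [affMap, Matrix.mulVec, dotProduct]

/-- A lattice-free body strictly contained in a slab between consecutive lattice planes is not
maximal. -/
lemma MemM3.not_subset_slab {P : Set (Fin 3 → ℝ)} (hM : MemM3 P) (c : ℤ) :
    ¬ P ⊆ (fun x => x 2) ⁻¹' Icc (c : ℝ) (c + 1) := by
  obtain ⟨-, hb, -, -, -, hmax⟩ := hM
  intro hsub
  have hP := hmax _ ((convex_Icc (c : ℝ) (c + 1)).is_linear_preimage
    (f := fun x : Fin 3 → ℝ => x 2) ⟨fun _ _ => rfl, fun _ _ => rfl⟩) ?_ hsub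
  · rw [hP] at hb
    obtain ⟨C, hC⟩ := isBounded_iff_forall_norm_le.1 hb
    have h := hC ![0, C + 1, c] (by simp)
    have h' := (le_abs_self _).trans ((norm_le_pi_norm ![0, C + 1, (c : ℝ)] 1).trans h)
    simp at h'
    linarith
  · rw [← (isOpenMap_eval (2 : Fin 3)).preimage_interior_eq_interior_preimage
      (continuous_apply _), interior_Icc]
    ext x
    simp only [mem_inter_iff, mem_preimage, mem_Ioo, mem_empty_iff_false, iff_false]
    rintro ⟨⟨h₁, h₂⟩, hx⟩
    obtain ⟨z, hz⟩ := hx 2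
    simp only [Function.eval, hz] at h₁ h₂
    norm_cast at h₁ h₂
    lia

lemma snd_eq_zero_of_mem_B11 {x : Fin 3 → ℝ} (hx : x ∈ B11) : x 2 = 0 := by
  have hc : Convex ℝ ((fun x : Fin 3 → ℝ => x 2) ⁻¹' {0}) :=
    (convex_singleton (0 : ℝ)).is_linear_preimage ⟨fun _ _ => rfl, fun _ _ => rfl⟩
  exact convexHull_min (by rintro y (rfl | rfl | rfl) <;> simp) hc hx

lemma mem_prism {w x : Fin 3 → ℝ} {l : ℝ} (hl₀ : 0 ≤ l) (hl₁ : l ≤ 1) (h : x - l • w ∈ B11) :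
    x ∈ convexHull ℝ (B11 ∪ (fun x => x + w) '' B11) := by
  have h₁ := subset_convexHull ℝ (B11 ∪ (fun x => x + w) '' B11) (Or.inl h)
  have h₂ := subset_convexHull ℝ (B11 ∪ (fun x => x + w) '' B11) (Or.inr ⟨_, h, rfl⟩)
  convert convex_convexHull ℝ _ h₁ h₂ (sub_nonneg.2 hl₁) hl₀ (by ring) using 1
  ext i
  simp
  ring

/-- The open prism with horizontal triangular base lies in the interior of the prism. -/
lemma mem_interior_prism {w x : Fin 3 → ℝ} (hw : w 2 ≠ 0)
    (hl₀ : 0 < x 2 / w 2) (hl₁ : x 2 / w 2 < 1)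
    (h₀ : 0 < x 1 - x 2 / w 2 * w 1)
    (h₁ : 2 * (x 0 - x 2 / w 2 * w 0) + (x 1 - x 2 / w 2 * w 1) < 2)
    (h₂ : -2 * (x 0 - x 2 / w 2 * w 0) + (x 1 - x 2 / w 2 * w 1) < 2) :
    x ∈ interior (convexHull ℝ (B11 ∪ (fun x => x + w) '' B11)) := by
  refine mem_interior.2 ⟨{x | 0 < x 2 / w 2 ∧ x 2 / w 2 < 1 ∧ 0 < x 1 - x 2 / w 2 * w 1 ∧
    2 * (x 0 - x 2 / w 2 * w 0) + (x 1 - x 2 / w 2 * w 1) < 2 ∧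
    -2 * (x 0 - x 2 / w 2 * w 0) + (x 1 - x 2 / w 2 * w 1) < 2}, ?_, ?_, hl₀, hl₁, h₀, h₁, h₂⟩
  · rintro y ⟨k₁, k₂, k₃, k₄, k₅⟩
    refine mem_prism k₁.le k₂.le (mem_B11 ?_ ?_ ?_ ?_)
    · simpa using k₃.le
    · simpa using k₄.le
    · simpa using k₅.le
    · simp [hw]
  · simp only [Set.ofPred_and]
    repeat' apply IsOpen.inter
    all_goals exact isOpen_lt (by fun_prop) (by fun_prop)

lemma prism_eq_image_M11 (a m s : ℤ) :
    convexHull ℝ (B11 ∪ (fun x => x + ![1 + 2 * (a : ℝ), 2 * (m : ℝ), 2 * (s : ℝ)]) '' B11) =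
      affMap !![1, 0, a; 0, 1, m; 0, 0, s] 0 '' M11 := by
  rw [affMap_zero_eq_toLin']
  set f := Matrix.toLin' ((!![1, 0, a; 0, 1, m; 0, 0, s] : Matrix (Fin 3) (Fin 3) ℤ).map
    (Int.cast : ℤ → ℝ)) with hf
  have hB : f '' B11 = B11 := by
    have e₁ : f ![1, 0, 0] = ![1, 0, 0] := by
      ext i; fin_cases i <;> simp [hf, Matrix.mulVec, dotProduct, Fin.sum_univ_three]
    have e₂ : f ![-1, 0, 0] = ![-1, 0, 0] := by
      ext i; fin_cases i <;> simp [hf, Matrix.mulVec, dotProduct, Fin.sum_univ_three]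
    have e₃ : f ![0, 2, 0] = ![0, 2, 0] := by
      ext i; fin_cases i <;> simp [hf, Matrix.mulVec, dotProduct, Fin.sum_univ_three]
    rw [B11, f.image_convexHull, image_insert_eq, image_insert_eq, image_singleton, e₁, e₂, e₃]
  have hw : f ![1, 0, 2] = ![1 + 2 * (a : ℝ), 2 * (m : ℝ), 2 * (s : ℝ)] := by
    ext i
    fin_cases i <;> simp [hf, Matrix.mulVec, dotProduct, Fin.sum_univ_three] <;> ring
  rw [M11, f.image_convexHull, image_union, image_image, hB]
  simp only [map_add, hw]
  rw [← image_image (fun x => x + _) f, hB]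

/-- A maximal lattice-free prism over the triangle `conv{±e₁, 2e₂}` is, up to a
unimodular transformation, the prism `M₁₁`. -/
theorem M3_prism_over_B11 (u : Fin 3 → ℤ) (hu : u 2 ≠ 0) (P : Set (Fin 3 → ℝ))
    (hP : P = convexHull ℝ (B11 ∪ (fun x => x + fun i => (u i : ℝ)) '' B11))
    (hM : MemM3 P) :
    ∃ (U : Matrix (Fin 3) (Fin 3) ℤ) (v : Fin 3 → ℤ),
      |U.det| = 1 ∧ P = affMap U (fun i => (v i : ℝ)) '' M11 := by
  have hslab : ∀ c : ℤ, c ≤ 0 → 0 ≤ c + 1 → c ≤ u 2 → u 2 ≤ c + 1 → False := by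
    intro c h₁ h₂ h₃ h₄
    refine hM.not_subset_slab c ?_
    rw [hP]
    refine convexHull_min ?_ ((convex_Icc (c : ℝ) (c + 1)).is_linear_preimage
      (f := fun x : Fin 3 → ℝ => x 2) ⟨fun _ _ => rfl, fun _ _ => rfl⟩)
    rintro y (hy | ⟨y, hy, rfl⟩)
    · simp only [mem_preimage, snd_eq_zero_of_mem_B11 hy, mem_Icc]
      exact ⟨by exact_mod_cast h₁, by exact_mod_cast h₂⟩
    · simp only [mem_preimage, Pi.add_apply, snd_eq_zero_of_mem_B11 hy, mem_Icc, zero_add]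
      exact ⟨by exact_mod_cast h₃, by exact_mod_cast h₄⟩
  obtain ⟨s, n, hs, hn, hsn⟩ : ∃ s n : ℤ, (s = 1 ∨ s = -1) ∧ 2 ≤ n ∧ u 2 = n * s := by
    have h₁ := hslab 0
    have h₂ := hslab (-1)
    rcases hu.lt_or_gt with h | h
    · exact ⟨-1, -u 2, by simp, by lia, by ring⟩
    · exact ⟨1, u 2, by simp, by lia, by ring⟩
  have hs0 : (s : ℝ) ≠ 0 := by rcases hs with rfl | rfl <;> simp
  have hnpos : (0 : ℝ) < n := by exact_mod_cast (by lia : 0 < n)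
  obtain ⟨rfl, ⟨a, ha⟩, m, hm⟩ := height_eq_two_of_forall_not_mem n (u 0) (u 1) hn (by
    intro a b k hk₀ hk₁ h₀ h₁ h₂
    have hk : (k * s : ℝ) / u 2 = k / n := by
      rw [hsn]
      push_cast
      field_simp
    have hmul : ∀ x y : ℤ, (x : ℝ) - k / n * y = ((n * x - k * y : ℤ) : ℝ) / n := by
      intro x y
      push_cast
      field_simp
    have hint : (![a, b, k * s] : Fin 3 → ℝ) ∈ interior P := by
      rw [hP]
      refine mem_interior_prism (by simpa using hu) ?_ ?_ ?_ ?_ ?_ <;>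
        simp only [Matrix.cons_val, Matrix.cons_val_zero, Matrix.cons_val_one, hk, hmul]
      · have : (0 : ℝ) < k := by exact_mod_cast hk₀
        positivity
      · rw [div_lt_one hnpos]
        exact_mod_cast hk₁
      · refine div_pos ?_ hnpos
        exact_mod_cast h₀
      · rw [← mul_div_assoc, ← add_div, div_lt_iff₀ hnpos]
        exact_mod_cast h₁
      · rw [← mul_div_assoc, ← add_div, div_lt_iff₀ hnpos]
        exact_mod_cast h₂
    have hempty := hM.2.2.2.2.1
    refine eq_empty_iff_forall_notMem.1 hempty _ ⟨hint, fun i => ?_⟩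
    fin_cases i
    · exact ⟨a, by simp⟩
    · exact ⟨b, by simp⟩
    · exact ⟨k * s, by simp⟩)
  refine ⟨!![1, 0, a; 0, 1, m; 0, 0, s], 0, ?_, ?_⟩
  · rcases hs with rfl | rfl <;> simp [Matrix.det_fin_three]
  · have hw : (fun i => (u i : ℝ)) = ![1 + 2 * (a : ℝ), 2 * (m : ℝ), 2 * (s : ℝ)] := by
      ext i
      fin_cases i <;> simp [ha, hm, hsn]
    have hv : (fun i => (((0 : Fin 3 → ℤ) i : ℤ) : ℝ)) = 0 := by
      ext i
      simp
    rw [hP, hw, hv, prism_eq_image_M11]
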